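/- Newton identities for Manin matrices: let M be an n×n Manin matrix, set q_m = tr_{1,…,m}(A_m M⁽¹⁾⋯M⁽ᵐ⁾) (equal to the sum of column determinants of all principal m×m submatrices), with q_0 = 1 and q_m = 0 for m > n. Then for every m ≥ 0: m·q_m = Σ_{k=0}^{m−1} (−1)^{m+k+1} q_k · tr(M^{m−k}). -/

import Mathlib

open Matrix

/-- `M` is a Manin matrix. -/
def IsManin {R : Type*} [Ring R] {n : ℕ} (M : Matrix (Fin n) (Fin n) R) : Prop :=
  (∀ i k j l : Fin n, i < k → j < l →
    M i j * M k l - M k l * M i j = M k j * M i l - M i l * M k j) ∧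
  (∀ i k j : Fin n, M i j * M k j = M k j * M i j)

/-- `M` acting in the `k`-th tensor leg of (ℂⁿ)^{⊗m} (identity elsewhere). -/
def leg {R : Type*} [Ring R] {n m : ℕ} (M : Matrix (Fin n) (Fin n) R) (k : Fin m) :
    Matrix (Fin m → Fin n) (Fin m → Fin n) R :=
  fun f g => if ∀ l, l ≠ k → f l = g l then M (f k) (g k) else 0

/-- Standard permutation representation of S_m on (ℂⁿ)^{⊗m}:
π(σ)(v₁⊗⋯⊗v_m) = v_{σ⁻¹(1)}⊗⋯⊗v_{σ⁻¹(m)}. -/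
def permMat (R : Type*) [Ring R] (n : ℕ) {m : ℕ} (σ : Equiv.Perm (Fin m)) :
    Matrix (Fin m → Fin n) (Fin m → Fin n) R :=
  fun f g => if f = g ∘ ⇑σ⁻¹ then 1 else 0

/-- The antisymmetrizer A_m = (1/m!) Σ_{σ ∈ S_m} sgn(σ) π(σ) on (ℂⁿ)^{⊗m}. -/
noncomputable def antisym (R : Type*) [Ring R] [Algebra ℚ R] (n m : ℕ) :
    Matrix (Fin m → Fin n) (Fin m → Fin n) R :=
  ((m.factorial : ℚ)⁻¹) •
    ∑ σ : Equiv.Perm (Fin m), ((Equiv.Perm.sign σ : ℤ) : ℚ) • permMat R n σ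

/-- The ordered product M⁽¹⁾·M⁽²⁾⋯M⁽ᵐ⁾ on (ℂⁿ)^{⊗m}. -/
def legProd {R : Type*} [Ring R] {n : ℕ} (M : Matrix (Fin n) (Fin n) R) (m : ℕ) :
    Matrix (Fin m → Fin n) (Fin m → Fin n) R :=
  (List.ofFn fun k : Fin m => leg M k).prod

section ManinAux

/-- Ordered product of entries. -/
def oprod {R : Type*} [Ring R] {m : ℕ} (u : Fin m → R) : R := (List.ofFn u).prod

lemma oprod_succ {R : Type*} [Ring R] {m : ℕ} (u : Fin (m+1) → R) :
    oprod u = u 0 * oprod (fun i => u i.succ) := by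
  simp [oprod, List.ofFn_succ]

lemma oprod_succ_last {R : Type*} [Ring R] {m : ℕ} (u : Fin (m+1) → R) :
    oprod u = oprod (fun i => u i.castSucc) * u (Fin.last m) := by
  simp only [oprod]
  rw [List.ofFn_succ', List.prod_concat]

lemma oprod_split {R : Type*} [Ring R] : ∀ {m : ℕ} (i : Fin m) (u₀ : Fin (m+1) → R),
    ∃ X Y : R, ∀ u : Fin (m+1) → R, (∀ k, k ≠ i.castSucc → k ≠ i.succ → u k = u₀ k) →
      oprod u = X * (u i.castSucc * u i.succ) * Y := by
  intro m
  induction m with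
  | zero => intro i; exact i.elim0
  | succ m ih =>
    intro i u₀
    refine Fin.cases ?_ ?_ i
    · refine ⟨1, oprod (fun i : Fin m => u₀ i.succ.succ), fun u hu => ?_⟩
      rw [oprod_succ, oprod_succ]
      have : (fun i : Fin m => u i.succ.succ) = fun i => u₀ i.succ.succ := by
        funext k
        apply hu
        · simp
        · intro h
          have := congrArg Fin.val h
          simp at this
      rw [this]
      simp [mul_assoc]
    · intro j
      obtain ⟨X, Y, h⟩ := ih j (fun k => u₀ k.succ)
      refine ⟨u₀ 0 * X, Y, fun u hu => ?_⟩
      rw [oprod_succ, h (fun k => u k.succ), hu 0]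
      · simp [mul_assoc]
      · intro h
        have := congrArg Fin.val h
        simp at this
      · intro h
        have := congrArg Fin.val h
        simp at this
      · intro k h1 h2
        apply hu
        · intro h; apply h1; ext; have := congrArg Fin.val h; simp at this; simp [this]
        · intro h; apply h2; ext; have := congrArg Fin.val h; simp at this; simp [this]

lemma manin_comm {R : Type*} [Ring R] {n : ℕ} {M : Matrix (Fin n) (Fin n) R} (hM : IsManin M)
    (a b j l : Fin n) :
    M a j * M b l - M b l * M a j = M b j * M a l - M a l * M b j := by
  obtain ⟨h1, h2⟩ := hM
  rcases lt_trichotomy j l with hj | rfl | hj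
  · rcases lt_trichotomy a b with ha | rfl | ha
    · exact h1 a b j l ha hj
    · rfl
    · exact (h1 b a j l ha hj).symm
  · rw [h2 a b j]
  · rcases lt_trichotomy a b with ha | rfl | ha
    · have := h1 a b l j ha hj
      rw [← neg_sub, ← this, neg_sub]
    · rfl
    · have := h1 b a l j ha hj
      rw [← neg_sub, this, neg_sub]

/-- Column determinant with rows `g` and columns `f`. -/
def cdet {R : Type*} [Ring R] {n m : ℕ} (M : Matrix (Fin n) (Fin n) R)
    (g f : Fin m → Fin n) : R :=
  ∑ σ : Equiv.Perm (Fin m), (Equiv.Perm.sign σ : ℤ) • oprod (fun i => M (g (σ i)) (f i))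

lemma cdet_comp_swap {R : Type*} [Ring R] {n m : ℕ} {M : Matrix (Fin n) (Fin n) R}
    (hM : IsManin M) (i : Fin m) (g f : Fin (m+1) → Fin n) :
    cdet M (g ∘ Equiv.swap i.castSucc i.succ) (f ∘ Equiv.swap i.castSucc i.succ) = cdet M g f := by
  set τ := Equiv.swap i.castSucc i.succ with hτ
  have hne : i.castSucc ≠ i.succ := by
    intro h
    have := congrArg Fin.val h
    simp at this
  have hττ : τ * τ = 1 := Equiv.swap_mul_self _ _
  have hττ' : ∀ x, τ (τ x) = x := fun x => Equiv.swap_apply_self _ _ _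
  have key : cdet M (g ∘ τ) (f ∘ τ) = ∑ σ : Equiv.Perm (Fin (m+1)),
      (Equiv.Perm.sign σ : ℤ) • oprod (fun i => M (g (σ (τ i))) (f (τ i))) := by
    unfold cdet
    refine Fintype.sum_equiv ((MulAut.conj τ).toEquiv) _ _ ?_
    intro σ
    have : (MulAut.conj τ).toEquiv σ = τ * σ * τ⁻¹ := rfl
    rw [this]
    congr 1
    · rw [Equiv.Perm.sign_mul, Equiv.Perm.sign_mul, Equiv.Perm.sign_inv, mul_right_comm]
      simp
    · congr 1
      funext k
      simp
  rw [key]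
  unfold cdet
  rw [← sub_eq_zero, ← Finset.sum_sub_distrib]
  refine Finset.sum_involution (fun σ _ => σ * τ) ?_ ?_ (fun _ _ => Finset.mem_univ _) ?_
  · intro σ _
    obtain ⟨X, Y, h⟩ := oprod_split i (fun k => M (g (σ k)) (f k))
    have hτk : ∀ k, k ≠ i.castSucc → k ≠ i.succ → τ k = k :=
      fun k h1 h2 => Equiv.swap_apply_of_ne_of_ne h1 h2
    have t1 : τ i.castSucc = i.succ := Equiv.swap_apply_left _ _
    have t2 : τ i.succ = i.castSucc := Equiv.swap_apply_right _ _
    have hs : (Equiv.Perm.sign (σ * τ) : ℤ) = - (Equiv.Perm.sign σ : ℤ) := by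
      rw [Equiv.Perm.sign_mul, hτ, Equiv.Perm.sign_swap hne]; simp
    rw [hs]
    simp only [Equiv.Perm.mul_apply, hττ']
    rw [h (fun k => M (g (σ k)) (f k)), h (fun k => M (g (σ (τ k))) (f (τ k))),
      h (fun k => M (g (σ k)) (f (τ k))), h (fun k => M (g (σ (τ k))) (f k))]
    · simp only [t1, t2]
      have hc := manin_comm hM (g (σ i.castSucc)) (g (σ i.succ)) (f i.castSucc) (f i.succ)
      rw [← smul_sub, ← smul_sub, neg_smul, ← sub_eq_add_neg, ← smul_sub]
      rw [← sub_mul, ← sub_mul, ← mul_sub, ← mul_sub, ← sub_mul, ← mul_sub]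
      have : ∀ a b c d : R, a - b = c - d → b - a - (d - c) = 0 := by
        intro a b c d h
        have : b - a - (d - c) = (c - d) - (a - b) := by abel
        rw [this, h, sub_self]
      rw [this _ _ _ _ hc]
      simp
    all_goals
      intro k h1 h2
      simp [hτk k h1 h2]
  · intro σ _ _ h
    have h1 : τ = 1 := by simpa using h
    have h2 : τ i.castSucc = i.succ := Equiv.swap_apply_left _ _
    rw [h1] at h2
    exact hne h2
  · intro σ _
    simp [mul_assoc, hττ]

lemma cdet_comp {R : Type*} [Ring R] {n m : ℕ} {M : Matrix (Fin n) (Fin n) R}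
    (hM : IsManin M) (τ : Equiv.Perm (Fin m)) (g f : Fin m → Fin n) :
    cdet M (g ∘ τ) (f ∘ τ) = cdet M g f := by
  cases m with
  | zero => 
    have : τ = 1 := Subsingleton.elim _ _
    subst this; rfl
  | succ m =>
    have hmem : τ ∈ Submonoid.closure
        (Set.range fun i : Fin m => Equiv.swap i.castSucc i.succ) := by
      rw [Equiv.Perm.mclosure_swap_castSucc_succ]; trivial
    induction hmem using Submonoid.closure_induction generalizing g f with
    | mem x hx =>
      obtain ⟨i, rfl⟩ := hx
      exact cdet_comp_swap hM i g f
    | one => rfl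
    | mul x y _ _ hx hy =>
      have := hy (g ∘ x) (f ∘ x)
      rw [hx] at this
      exact this

lemma sum_perm_last {A : Type*} [AddCommGroup A] {m : ℕ} (F : Equiv.Perm (Fin (m+1)) → A) :
    ∑ σ, F σ = ∑ p : Option (Fin m) × Equiv.Perm (Fin m),
      F (finSuccEquivLast.symm.permCongr (Equiv.Perm.decomposeOption.symm p)) := by
  symm
  exact Fintype.sum_equiv
    (Equiv.Perm.decomposeOption.symm.trans finSuccEquivLast.symm.permCongr) _ _ (fun _ => rfl)

lemma cdet_snoc {R : Type*} [Ring R] {n m : ℕ} (M : Matrix (Fin n) (Fin n) R)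
    (h : Fin m → Fin n) (a b : Fin n) :
    cdet M (Fin.snoc h a : Fin (m+1) → Fin n) (Fin.snoc h b : Fin (m+1) → Fin n) =
      cdet M h h * M a b - ∑ j, cdet M (Function.update h j a) h * M (h j) b := by
  unfold cdet
  rw [sum_perm_last, Fintype.sum_prod_type, Fintype.sum_option, sub_eq_add_neg]
  congr 1
  · rw [Finset.sum_mul]
    refine Finset.sum_congr rfl fun σ _ => ?_
    rw [oprod_succ_last, smul_mul_assoc]
    simp [Equiv.permCongr_apply]
  · rw [← Finset.sum_neg_distrib]
    refine Finset.sum_congr rfl fun j _ => ?_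
    rw [Finset.sum_mul, ← Finset.sum_neg_distrib]
    refine Finset.sum_congr rfl fun σ _ => ?_
    rw [oprod_succ_last, smul_mul_assoc, ← neg_smul]
    have hk : ∀ k, (Fin.snoc h a : Fin (m+1) → Fin n) (finSuccEquivLast.symm
        (Equiv.swap none (some j) (some (σ k)))) = Function.update h j a (σ k) := by
      intro k
      by_cases hj : σ k = j
      · simp [hj]
      · rw [Equiv.swap_apply_of_ne_of_ne (by simp) (by simpa using hj)]
        simp [hj]
    congr 1
    · simp
    · simp [Equiv.permCongr_apply, hk]

/-- Unnormalized sum of column determinants. -/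
def qsum {R : Type*} [Ring R] {n : ℕ} (M : Matrix (Fin n) (Fin n) R) (m : ℕ) : R :=
  ∑ h : Fin m → Fin n, cdet M h h

/-- Unnormalized partial trace. -/
def umat {R : Type*} [Ring R] {n : ℕ} (M : Matrix (Fin n) (Fin n) R) (m : ℕ) :
    Matrix (Fin n) (Fin n) R := fun a c =>
  ∑ j : Fin m, ∑ h : Fin m → Fin n, if h j = c then cdet M (Function.update h j a) h else 0

lemma trace_umat {R : Type*} [Ring R] {n : ℕ} (M : Matrix (Fin n) (Fin n) R) (m : ℕ) :
    (umat M m).trace = m • qsum M m := by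
  simp only [Matrix.trace, Matrix.diag, umat, qsum]
  rw [Finset.sum_comm]
  have : ∀ j : Fin m, (∑ a, ∑ h : Fin m → Fin n,
      if h j = a then cdet M (Function.update h j a) h else 0) = ∑ h : Fin m → Fin n, cdet M h h := by
    intro j
    rw [Finset.sum_comm]
    refine Finset.sum_congr rfl fun h _ => ?_
    simp
  simp [this]

lemma umat_succ {R : Type*} [Ring R] {n : ℕ} {M : Matrix (Fin n) (Fin n) R} (hM : IsManin M)
    (m : ℕ) (a b : Fin n) :
    umat M (m+1) a b = (m+1) • (qsum M m * M a b - (umat M m * M) a b) := by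
  have h1 : ∀ j : Fin (m+1), (∑ h : Fin (m+1) → Fin n,
      if h j = b then cdet M (Function.update h j a) h else 0) =
      ∑ h : Fin (m+1) → Fin n,
      if h (Fin.last m) = b then cdet M (Function.update h (Fin.last m) a) h else 0 := by
    intro j
    set τ := Equiv.swap j (Fin.last m) with hτ
    refine Fintype.sum_equiv (Equiv.arrowCongr τ (Equiv.refl _)) _ _ fun h => ?_
    have e : (Equiv.arrowCongr τ (Equiv.refl (Fin n))) h = h ∘ τ := by
      funext k; simp [Equiv.arrowCongr, hτ]
    rw [e]
    have e2 : Function.update (h ∘ τ) (Fin.last m) a = Function.update h j a ∘ τ := by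
      rw [Function.update_comp_equiv]
      simp [hτ]
    rw [e2, cdet_comp hM]
    simp [hτ]
  have h2 : (∑ h : Fin (m+1) → Fin n,
      if h (Fin.last m) = b then cdet M (Function.update h (Fin.last m) a) h else 0) =
      ∑ h : Fin m → Fin n, cdet M (Fin.snoc h a : Fin (m+1) → Fin n)
        (Fin.snoc h b : Fin (m+1) → Fin n) := by
    rw [← (Fin.snocEquiv (fun _ : Fin (m+1) => Fin n)).sum_comp, Fintype.sum_prod_type]
    rw [Finset.sum_comm]
    refine Finset.sum_congr rfl fun h _ => ?_
    have e : ∀ c, (Fin.snocEquiv (fun _ : Fin (m+1) => Fin n)) (c, h) =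
        (Fin.snoc h c : Fin (m+1) → Fin n) := fun c => rfl
    simp only [e, Fin.snoc_last, Fin.update_snoc_last]
    simp
  have h3 : umat M (m+1) a b = ∑ j : Fin (m+1), ∑ h : Fin (m+1) → Fin n,
      if h j = b then cdet M (Function.update h j a) h else 0 := rfl
  rw [h3]
  simp only [h1, h2, cdet_snoc]
  rw [Finset.sum_const, Finset.card_univ, Fintype.card_fin, Finset.sum_sub_distrib]
  congr 2
  · simp [qsum, Finset.sum_mul]
  · simp only [Matrix.mul_apply, umat, Finset.sum_mul]
    rw [Finset.sum_comm]
    rw [Finset.sum_comm (s := (Finset.univ : Finset (Fin n)))]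
    refine Finset.sum_congr rfl fun j _ => ?_
    rw [Finset.sum_comm (s := (Finset.univ : Finset (Fin n)))]
    refine Finset.sum_congr rfl fun h _ => ?_
    simp [ite_mul]

lemma legProd_aux {R : Type*} [Ring R] {n m : ℕ} (M : Matrix (Fin n) (Fin n) R) :
    ∀ (l : ℕ) (hl : l ≤ m) (f g : Fin m → Fin n),
    (List.ofFn fun k : Fin l => leg M (Fin.castLE hl k)).prod f g =
      if ∀ i : Fin m, l ≤ i → f i = g i then
        oprod (fun k : Fin l => M (f (Fin.castLE hl k)) (g (Fin.castLE hl k))) else 0 := by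
  intro l
  induction l with
  | zero =>
    intro hl f g
    simp [oprod, Matrix.one_apply, funext_iff]
  | succ l ih =>
    intro hl f g
    rw [List.ofFn_succ', List.prod_concat, Matrix.mul_apply]
    have ih' := ih (Nat.le_of_succ_le hl)
    have e : (fun k : Fin l => leg M (Fin.castLE hl k.castSucc)) =
      fun k : Fin l => leg M (Fin.castLE (Nat.le_of_succ_le hl) k) := rfl
    simp only [e, ih']
    set L : Fin m := Fin.castLE hl (Fin.last l) with hL
    have hLv : (L : ℕ) = l := rfl
    rw [Fintype.sum_eq_single (Function.update g L (f L))]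
    · have c2 : ∀ j, j ≠ L → Function.update g L (f L) j = g j := fun j hj => by simp [hj]
      have c1 : (∀ i : Fin m, l ≤ i → f i = Function.update g L (f L) i) ↔
          ∀ i : Fin m, l + 1 ≤ i → f i = g i := by
        constructor
        · intro h i hi
          rw [h i (by omega), c2]
          intro h; rw [h] at hi; omega
        · intro h i hi
          by_cases hi' : i = L
          · simp [hi']
          · rw [c2 i hi']
            apply h
            have : (i : ℕ) ≠ L := fun h => hi' (Fin.ext h)
            omega
      rw [oprod_succ_last]
      simp only [leg, c1]
      rw [if_pos c2]
      split_ifs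
      · congr 1
        · congr 1
          funext k
          rw [c2]
          · rfl
          · intro h
            have := congrArg Fin.val h
            have hk := k.2
            simp [hLv] at this
            omega
        · simp [hL]
      · simp
    · intro x hx
      by_cases h1 : ∀ i : Fin m, l ≤ i → f i = x i
      · have : ¬ ∀ j, j ≠ L → x j = g j := by
          intro h2
          apply hx
          funext j
          by_cases hj : j = L
          · subst hj
            simp [h1 L hLv.ge]
          · simp [hj, h2 j hj]
        simp only [leg]
        rw [if_neg this, mul_zero]
      · rw [if_neg h1, zero_mul]

lemma legProd_apply {R : Type*} [Ring R] {n m : ℕ} (M : Matrix (Fin n) (Fin n) R)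
    (f g : Fin m → Fin n) : legProd M m f g = oprod (fun k => M (f k) (g k)) := by
  have := legProd_aux M m le_rfl f g
  rw [if_pos] at this
  · exact this
  · intro i hi
    exact absurd i.2 (by omega)

lemma trace_antisym {R : Type*} [Ring R] [Algebra ℚ R] {n : ℕ} (M : Matrix (Fin n) (Fin n) R)
    (m : ℕ) : Matrix.trace (antisym R n m * legProd M m) =
      ((m.factorial : ℚ)⁻¹) • qsum M m := by
  unfold antisym qsum cdet
  rw [Matrix.smul_mul, Matrix.trace_smul, Matrix.sum_mul, Matrix.trace_sum, Finset.sum_comm]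
  congr 1
  refine Finset.sum_congr rfl fun σ _ => ?_
  rw [Matrix.smul_mul, Matrix.trace_smul, ← Finset.smul_sum, Int.cast_smul_eq_zsmul]
  congr 1
  simp only [Matrix.trace, Matrix.diag, Matrix.mul_apply, legProd_apply, permMat]
  refine Finset.sum_congr rfl fun f _ => ?_
  rw [Fintype.sum_eq_single (f ∘ σ)]
  · rw [if_pos]
    · simp
    · funext k; simp
  · intro x hx
    rw [if_neg, zero_mul]
    intro h
    apply hx
    rw [h]
    funext k; simp

end ManinAux

/-- Newton identities for Manin matrices:
with q_m = tr(A_m M⁽¹⁾⋯M⁽ᵐ⁾) (so q_0 = 1 and q_m = 0 for m > n),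
m·q_m = Σ_{k=0}^{m−1} (−1)^{m+k+1} q_k · tr(M^{m−k}). -/
theorem newton_identities_manin {R : Type*} [Ring R] [Algebra ℚ R] {n : ℕ}
    (M : Matrix (Fin n) (Fin n) R) (hM : IsManin M)
    (q : ℕ → R) (hq : ∀ m, q m = Matrix.trace (antisym R n m * legProd M m))
    (m : ℕ) :
    m • q m = ∑ k ∈ Finset.range m,
      (-1 : R) ^ (m + k + 1) * (q k * Matrix.trace (M ^ (m - k))) := by
  have hq' : ∀ m, q m = ((m.factorial : ℚ)⁻¹) • qsum M m := fun m => by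
    rw [hq, trace_antisym]
  have hV : ∀ m, ((m.factorial : ℚ)⁻¹) • umat M m = ∑ k ∈ Finset.range m,
      (-1 : ℤ) ^ (m + k + 1) • (q k • M ^ (m - k)) := by
    intro m
    induction m with
    | zero => ext a b; simp [umat]
    | succ m ih =>
      have hstep : (((m+1).factorial : ℚ)⁻¹) • umat M (m+1) =
          q m • M - (((m.factorial : ℚ)⁻¹) • umat M m) * M := by
        ext a b
        rw [Matrix.smul_apply, umat_succ hM, Matrix.smul_mul, Matrix.sub_apply,
          Matrix.smul_apply, Matrix.smul_apply, hq' m, smul_eq_mul, smul_mul_assoc, ← smul_sub,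
          ← Nat.cast_smul_eq_nsmul ℚ, smul_smul]
        congr 1
        rw [Nat.factorial_succ]
        have : ((m : ℚ) + 1) ≠ 0 := by positivity
        have : (m.factorial : ℚ) ≠ 0 := by positivity
        push_cast
        field_simp
      rw [hstep, ih, Finset.sum_range_succ, Finset.sum_mul, sub_eq_neg_add,
        ← Finset.sum_neg_distrib]
      congr 1
      · refine Finset.sum_congr rfl fun k hk => ?_
        have hk' := Finset.mem_range.1 hk
        have e1 : m + 1 - k = (m - k) + 1 := by omega
        have e2 : m + 1 + k + 1 = (m + k + 1) + 1 := by omega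
        rw [e1, e2, pow_succ M, pow_succ (-1 : ℤ) (m + k + 1), smul_mul_assoc, smul_mul_assoc, mul_neg_one,
          neg_smul]
      · have e2 : m + 1 + m + 1 = 2 * (m + 1) := by omega
        rw [e2, pow_mul]
        simp
  have h := congrArg Matrix.trace (hV m)
  rw [Matrix.trace_smul, trace_umat, smul_comm, ← hq' m, Matrix.trace_sum] at h
  rw [h]
  refine Finset.sum_congr rfl fun k _ => ?_
  rw [Matrix.trace_smul, Matrix.trace_smul, zsmul_eq_mul, smul_eq_mul]
  simp
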